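/- Fix τ > 0. For f ∈ L²((0,τ)) define (Φ̃_τ f)(s) = ∫₀^τ [s e^{−s²/(4(τ−σ))} / (2√π (τ−σ)^{3/2})] f(σ) dσ for s ∈ Δ. Then Φ̃_τ f is holomorphic on Δ and ∫_Δ |(Φ̃_τ f)(z)|² dA(z) = ∫₀^τ |f(σ)|² dσ; that is, Φ̃_τ is an isometry from L²((0,τ)) into the Bergman space A²(Δ). -/

import Mathlib

open MeasureTheory Set

noncomputable section

/-- The open sector `Δ = {z : |arg z| < π/4}`. -/
def SectorDelta : Set ℂ := {z : ℂ | 0 < z.re ∧ |z.im| < z.re}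

/-- The reflected sector `π − Δ`. -/
def SectorPiDelta : Set ℂ := (fun z => (Real.pi : ℂ) - z) '' SectorDelta

/-- The open square `D = Δ ∩ (π − Δ)` with vertices `0, π/2 − iπ/2, π, π/2 + iπ/2`. -/
def SquareD : Set ℂ := SectorDelta ∩ SectorPiDelta

/-- Membership in the Bergman space `A²(Ω)`. -/
def MemA2 (Ω : Set ℂ) (f : ℂ → ℂ) : Prop :=
  DifferentiableOn ℂ f Ω ∧ ∫⁻ z in Ω, ENNReal.ofReal (‖f z‖ ^ 2) < ⊤

/-- Membership in the weighted Bergman space `A²(Ω, w)`. -/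
def MemA2W (Ω : Set ℂ) (w : ℂ → ℝ) (f : ℂ → ℂ) : Prop :=
  DifferentiableOn ℂ f Ω ∧ ∫⁻ z in Ω, ENNReal.ofReal (‖f z‖ ^ 2 * w z) < ⊤

/-- `log⁺ t = max (log t) 0`. -/
def logPlus (t : ℝ) : ℝ := Real.log (max t 1)

/-- Starting vertices of the four sides of `∂D`, counterclockwise. -/
def sideStart : Fin 4 → ℂ
  | 0 => 0
  | 1 => ((Real.pi / 2 : ℝ) : ℂ) * (1 - Complex.I)
  | 2 => ((Real.pi : ℝ) : ℂ)
  | 3 => ((Real.pi / 2 : ℝ) : ℂ) * (1 + Complex.I)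

/-- Direction vectors of the four sides of `∂D`, counterclockwise. -/
def sideDir : Fin 4 → ℂ
  | 0 => ((Real.pi / 2 : ℝ) : ℂ) * (1 - Complex.I)
  | 1 => ((Real.pi / 2 : ℝ) : ℂ) * (1 + Complex.I)
  | 2 => ((Real.pi / 2 : ℝ) : ℂ) * (Complex.I - 1)
  | 3 => -(((Real.pi / 2 : ℝ) : ℂ) * (1 + Complex.I))

/-- Parametrization of the `k`-th side of `∂D`. -/
def sidePath (k : Fin 4) (t : ℝ) : ℂ := sideStart k + (t : ℂ) * sideDir k

/-- `g` is arclength-integrable on `∂D` (each side has constant speed). -/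
def BoundaryIntegrable (g : ℂ → ℂ) : Prop :=
  ∀ k : Fin 4, IntervalIntegrable (fun t => ‖g (sidePath k t)‖) volume 0 1

/-- `∫_{∂D} |g| log⁺|g| |du| < ∞` (each side has constant speed). -/
def BoundaryLlogL (g : ℂ → ℂ) : Prop :=
  ∀ k : Fin 4, IntervalIntegrable
    (fun t => ‖g (sidePath k t)‖ * logPlus ‖g (sidePath k t)‖) volume 0 1

/-- The Cauchy integral `(1/(2πi)) ∮_{∂D} g(u)/(u − z) du`, `∂D` counterclockwise. -/
def cauchyD (g : ℂ → ℂ) (z : ℂ) : ℂ :=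
  (2 * (Real.pi : ℂ) * Complex.I)⁻¹ *
    ∑ k : Fin 4, ∫ t in (0:ℝ)..1, g (sidePath k t) * sideDir k / (sidePath k t - z)

/-- The Cauchy transform `(𝒞g)(z) = (1/(iπ)) ∫_ℝ g(t)/(t − z) dt` on the upper half-plane. -/
def cauchyTransform (g : ℝ → ℂ) (z : ℂ) : ℂ :=
  (Complex.I * (Real.pi : ℂ))⁻¹ * ∫ t : ℝ, g t / ((t : ℂ) - z)


/-- The operator `Φ̃_τ`:
`(Φ̃_τ f)(s) = ∫₀^τ s e^{−s²/(4(τ−σ))} / (2√π (τ−σ)^{3/2}) f(σ) dσ`. -/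
def PhiTilde (τ : ℝ) (f : ℝ → ℂ) (s : ℂ) : ℂ :=
  ∫ σ in Ioo (0:ℝ) τ,
    s * Complex.exp (-s ^ 2 / (4 * ((τ : ℂ) - (σ : ℂ)))) /
      (2 * ((Real.sqrt Real.pi : ℝ) : ℂ) * (((τ - σ) ^ ((3:ℝ)/2) : ℝ) : ℂ)) * f σ

open scoped FourierTransform SchwartzMap ContDiff

theorem plancherel_aux (f : ℝ → ℂ) (h1 : Integrable f) (h2 : MemLp f 2) :
    ∫⁻ ξ, ENNReal.ofReal (‖𝓕 f ξ‖ ^ 2) = ∫⁻ x, ENNReal.ofReal (‖f x‖ ^ 2) := by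
  set F2 : Lp ℂ 2 (volume : Measure ℝ) := h2.toLp f with hF2
  have hcont : Continuous (𝓕 f) :=
    VectorFourier.fourierIntegral_continuous Real.continuous_fourierChar
      (by exact continuous_inner) h1
  have hae : ∀ᵐ x, (𝓕 f) x = (𝓕 F2 : Lp ℂ 2 (volume : Measure ℝ)) x := by
    apply ae_eq_of_integral_contDiff_smul_eq
    · exact hcont.locallyIntegrable
    · exact (Lp.memLp (𝓕 F2)).locallyIntegrable (by norm_num)
    intro g hg hgs
    have hgs' : HasCompactSupport (fun x => (g x : ℂ)) := hgs.comp_left (g := Complex.ofReal) (by simp)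
    have hg' : ContDiff ℝ ∞ (fun x => (g x : ℂ)) := Complex.ofRealCLM.contDiff.comp hg
    let φ : 𝓢(ℝ, ℂ) := hgs'.toSchwartzMap hg'
    have hφ : ∀ x, φ x = (g x : ℂ) := fun x => rfl
    have e1 : (∫ x, φ x • (𝓕 F2 : Lp ℂ 2 (volume : Measure ℝ)) x) = ∫ x, (𝓕 φ) x • F2 x := by
      rw [← Lp.toTemperedDistribution_apply, ← Lp.toTemperedDistribution_apply,
        ← Lp.fourier_toTemperedDistribution_eq, TemperedDistribution.fourier_apply]
    have e2 : (∫ x, (𝓕 φ) x • F2 x) = ∫ x, (𝓕 φ) x • f x := by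
      apply integral_congr_ae
      filter_upwards [h2.coeFn_toLp] with x hx
      rw [hF2, hx]
    have e3 : (∫ x, (𝓕 φ) x • f x) = ∫ x, φ x • 𝓕 f x := by
      have := VectorFourier.integral_fourierIntegral_smul_eq_flip (μ := (volume : Measure ℝ))
        (ν := (volume : Measure ℝ)) (L := innerₗ ℝ)
        (f := (φ : ℝ → ℂ)) (g := f) Real.continuous_fourierChar (by exact continuous_inner) φ.integrable h1
      rw [flip_innerₗ] at this
      rw [SchwartzMap.fourier_coe]
      exact this
    have e4 := (e1.trans (e2.trans e3)).symm
    simp only [hφ] at e4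
    simpa using e4
  have hn : eLpNorm (𝓕 F2 : Lp ℂ 2 (volume : Measure ℝ)) 2 volume = eLpNorm F2 2 volume := by
    have := Lp.norm_fourier_eq F2
    rw [Lp.norm_def, Lp.norm_def, ENNReal.toReal_eq_toReal_iff' (Lp.eLpNorm_ne_top _) (Lp.eLpNorm_ne_top _)] at this
    exact this
  have hn' : eLpNorm (𝓕 f) 2 volume = eLpNorm f 2 volume := by
    rw [eLpNorm_congr_ae hae, hn, eLpNorm_congr_ae h2.coeFn_toLp]
  have key : ∀ h : ℝ → ℂ, ∫⁻ x, ENNReal.ofReal (‖h x‖ ^ 2) = (eLpNorm h 2 volume) ^ 2 := by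
    intro h
    have := eLpNorm_nnreal_pow_eq_lintegral (f := h) (μ := volume) (p := 2) (by norm_num)
    simp only [NNReal.coe_ofNat, ENNReal.coe_ofNat, ENNReal.rpow_ofNat] at this
    rw [this]
    congr 1
    ext x
    rw [ENNReal.ofReal_pow (norm_nonneg _), ofReal_norm]
  rw [key, key, hn']

/-- Laplace transform of a function on the line. -/
def lapAux (g : ℝ → ℂ) (w : ℂ) : ℂ := ∫ u : ℝ, Complex.exp (-w * u) * g u

theorem norm_kernel_aux (w : ℂ) (u : ℝ) : ‖Complex.exp (-w * u)‖ = Real.exp (-w.re * u) := by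
  rw [Complex.norm_exp]; simp

theorem integrable_pow_exp_aux (b : ℝ) (hb : 0 < b) (n : ℕ) :
    Integrable ((Ioi (0:ℝ)).indicator fun u => u ^ n * Real.exp (-b * u)) := by
  rw [integrable_indicator_iff measurableSet_Ioi]
  have := integrableOn_rpow_mul_exp_neg_mul_rpow (p := 1) (s := n) (b := b)
    (by have : (0:ℝ) ≤ n := Nat.cast_nonneg n
        linarith) one_pos hb
  simpa using this

theorem integrable_lap_aux (g : ℝ → ℂ) (hg : Measurable g) (h0 : ∀ u ≤ 0, g u = 0)
    (hi : Integrable fun u => ‖g u‖ ^ 2 / u) (b : ℝ) (hb : 0 < b) (n : ℕ) :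
    Integrable fun u => u ^ n * Real.exp (-b * u) * ‖g u‖ := by
  refine Integrable.mono' ((integrable_pow_exp_aux (2 * b) (by linarith) (2 * n + 1)).add hi)
    (by fun_prop) (ae_of_all _ fun u => ?_)
  rcases le_or_gt u 0 with hu | hu
  · simp [h0 u hu, hu.not_gt]
  · have e : Real.exp (-(2 * b) * u) = Real.exp (-b * u) ^ 2 := by
      rw [← Real.exp_nat_mul]; congr 1; push_cast; ring
    simp only [Pi.add_apply, indicator_of_mem (mem_Ioi.2 hu)]
    rw [Real.norm_of_nonneg (by positivity), e]
    have h3 : ‖g u‖ ^ 2 / u + u * (u ^ n * Real.exp (-b * u)) ^ 2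
        - 2 * (u ^ n * Real.exp (-b * u) * ‖g u‖) =
        (‖g u‖ - u * (u ^ n * Real.exp (-b * u))) ^ 2 / u := by
      field_simp; ring
    have h4 : 0 ≤ (‖g u‖ - u * (u ^ n * Real.exp (-b * u))) ^ 2 / u := by positivity
    have h5 : 0 ≤ u ^ n * Real.exp (-b * u) * ‖g u‖ := by positivity
    have h6 : u ^ (2 * n + 1) * Real.exp (-b * u) ^ 2 = u * (u ^ n * Real.exp (-b * u)) ^ 2 := by
      ring
    rw [h6]
    linarith

theorem lap_integrable (g : ℝ → ℂ) (hg : Measurable g) (h0 : ∀ u ≤ 0, g u = 0)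
    (hi : Integrable fun u => ‖g u‖ ^ 2 / u) (w : ℂ) (hw : 0 < w.re) :
    Integrable fun u : ℝ => Complex.exp (-w * u) * g u := by
  refine Integrable.mono' (integrable_lap_aux g hg h0 hi w.re hw 0)
    (by fun_prop) (ae_of_all _ fun u => ?_)
  rw [norm_mul, norm_kernel_aux]; simp

theorem lap_differentiableAt (g : ℝ → ℂ) (hg : Measurable g) (h0 : ∀ u ≤ 0, g u = 0)
    (hi : Integrable fun u => ‖g u‖ ^ 2 / u) (w : ℂ) (hw : 0 < w.re) :
    DifferentiableAt ℂ (lapAux g) w := by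
  have hs : {z : ℂ | w.re / 2 < z.re} ∈ nhds w :=
    (isOpen_lt continuous_const Complex.continuous_re).mem_nhds (by
      change w.re / 2 < w.re; linarith)
  have := hasDerivAt_integral_of_dominated_loc_of_deriv_le (μ := (volume : Measure ℝ))
    (F := fun (w : ℂ) (u : ℝ) => Complex.exp (-w * u) * g u)
    (F' := fun (w : ℂ) (u : ℝ) => Complex.exp (-w * u) * (-u) * g u)
    (bound := fun u => u ^ 1 * Real.exp (-(w.re / 2) * u) * ‖g u‖) hs
    (Filter.Eventually.of_forall fun z => by fun_prop)
    (lap_integrable g hg h0 hi w hw) (by fun_prop)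
    (ae_of_all _ fun u z hz => by
      rcases le_or_gt u 0 with hu | hu
      · simp [h0 u hu]
      · rw [norm_mul, norm_mul, norm_kernel_aux, norm_neg, Complex.norm_real,
          Real.norm_of_nonneg hu.le, mul_comm (Real.exp _), pow_one]
        have : w.re / 2 < z.re := hz
        gcongr)
    (integrable_lap_aux g hg h0 hi _ (by linarith) 1)
    (ae_of_all _ fun u z hz => by
      have h1 : HasDerivAt (fun z : ℂ => -z * u) (-u : ℂ) z := by
        simpa using (hasDerivAt_id z).neg.mul_const (u : ℂ)
      exact (h1.cexp).mul_const (g u))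
  exact this.2.differentiableAt

theorem lap_stronglyMeasurable (g : ℝ → ℂ) (hg : Measurable g) : Measurable (lapAux g) := by
  have : StronglyMeasurable (lapAux g) := by
    apply StronglyMeasurable.integral_prod_right (f := fun (w : ℂ) (u : ℝ) => Complex.exp (-w * u) * g u)
    apply Measurable.stronglyMeasurable
    simp only [Function.uncurry_def]
    fun_prop
  exact this.measurable

theorem lap_memLp (g : ℝ → ℂ) (hg : Measurable g) (h0 : ∀ u ≤ 0, g u = 0)
    (hi : Integrable fun u => ‖g u‖ ^ 2 / u) (x : ℝ) (hx : 0 < x) :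
    MemLp (fun u : ℝ => Complex.exp (-x * u) * g u) 2 := by
  rw [memLp_two_iff_integrable_sq_norm (by fun_prop)]
  refine Integrable.mono' (hi.const_mul (1 / (2 * x))) (by fun_prop) (ae_of_all _ fun u => ?_)
  rcases le_or_gt u 0 with hu | hu
  · simp [h0 u hu]
  rw [Real.norm_of_nonneg (by positivity), norm_mul, norm_kernel_aux, mul_pow,
    ← Real.exp_nat_mul]
  simp only [Complex.ofReal_re, Nat.cast_ofNat]
  have h1 : 2 * x * u * Real.exp (2 * (-x * u)) ≤ 1 := by
    have := Real.add_one_le_exp (2 * x * u)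
    have e : Real.exp (2 * (-x * u)) = (Real.exp (2 * x * u))⁻¹ := by
      rw [← Real.exp_neg]; congr 1; ring
    rw [e, ← div_eq_mul_inv, div_le_one (Real.exp_pos _)]
    linarith
  have h2 : 1 / (2 * x) * (‖g u‖ ^ 2 / u) - Real.exp (2 * (-x * u)) * ‖g u‖ ^ 2
    = (1 - 2 * x * u * Real.exp (2 * (-x * u))) * (‖g u‖ ^ 2 / (2 * x * u)) := by
    field_simp
  have h3 : 0 ≤ (1 - 2 * x * u * Real.exp (2 * (-x * u))) * (‖g u‖ ^ 2 / (2 * x * u)) :=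
    mul_nonneg (by linarith) (by positivity)
  linarith

theorem lap_vertical (g : ℝ → ℂ) (hg : Measurable g) (h0 : ∀ u ≤ 0, g u = 0)
    (hi : Integrable fun u => ‖g u‖ ^ 2 / u) (x : ℝ) (hx : 0 < x) :
    ∫⁻ y : ℝ, ENNReal.ofReal (‖lapAux g (⟨x, y⟩ : ℂ)‖ ^ 2) =
      ENNReal.ofReal (2 * Real.pi) *
        ∫⁻ u, ENNReal.ofReal (Real.exp (-(2 * u) * x)) * ENNReal.ofReal (‖g u‖ ^ 2) := by
  have hP := plancherel_aux (fun u : ℝ => Complex.exp (-x * u) * g u)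
    (lap_integrable g hg h0 hi x (by simpa using hx)) (lap_memLp g hg h0 hi x hx)
  have hpi := Real.pi_pos
  have hF : ∀ ξ : ℝ, 𝓕 (fun u : ℝ => Complex.exp (-x * u) * g u) ξ
      = lapAux g (⟨x, 2 * Real.pi * ξ⟩ : ℂ) := by
    intro ξ
    rw [Real.fourier_eq', lapAux]
    congr 1
    ext u
    rw [smul_eq_mul, ← mul_assoc, ← Complex.exp_add]
    congr 2
    apply Complex.ext <;> simp
    ring
  simp only [hF] at hP
  have hm : Measurable fun y : ℝ => ENNReal.ofReal (‖lapAux g (⟨x, y⟩ : ℂ)‖ ^ 2) := by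
    have h1 : Measurable fun y : ℝ => (⟨x, y⟩ : ℂ) := by
      have : (fun y : ℝ => (⟨x, y⟩ : ℂ)) = fun y : ℝ => (x : ℂ) + y * Complex.I := by
        ext y; exact Complex.mk_eq_add_mul_I x y
      rw [this]; fun_prop
    have := (lap_stronglyMeasurable g hg).comp h1
    exact (this.norm.pow_const 2).ennreal_ofReal
  have hsc : ∫⁻ y : ℝ, ENNReal.ofReal (‖lapAux g (⟨x, y⟩ : ℂ)‖ ^ 2) =
      ENNReal.ofReal (2 * Real.pi) *
      ∫⁻ ξ : ℝ, ENNReal.ofReal (‖lapAux g (⟨x, 2 * Real.pi * ξ⟩ : ℂ)‖ ^ 2) := by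
    conv_lhs => rw [← Real.smul_map_volume_mul_left (a := 2 * Real.pi) (by positivity)]
    rw [lintegral_smul_measure, lintegral_map hm (by fun_prop), abs_of_pos (by positivity),
      smul_eq_mul]
  rw [hsc, hP]
  congr 2
  ext u
  rw [← ENNReal.ofReal_mul (Real.exp_pos _).le, norm_mul, norm_kernel_aux, mul_pow,
    ← Real.exp_nat_mul]
  simp only [Complex.ofReal_re, Nat.cast_ofNat]
  congr 3
  ring_nf

theorem lap_halfplane (g : ℝ → ℂ) (hg : Measurable g) (h0 : ∀ u ≤ 0, g u = 0)
    (hi : Integrable fun u => ‖g u‖ ^ 2 / u) :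
    ∫⁻ w in {w : ℂ | 0 < w.re}, ENNReal.ofReal (‖lapAux g w‖ ^ 2) =
      ENNReal.ofReal Real.pi * ∫⁻ u, ENNReal.ofReal (‖g u‖ ^ 2 / u) := by
  have hpi := Real.pi_pos
  have hmL : Measurable fun w => ENNReal.ofReal (‖lapAux g w‖ ^ 2) :=
    ((lap_stronglyMeasurable g hg).norm.pow_const 2).ennreal_ofReal
  have hset : MeasurableSet {w : ℂ | 0 < w.re} := measurableSet_lt measurable_const Complex.measurable_re
  rw [← (Complex.volume_preserving_equiv_real_prod.symm).setLIntegral_comp_preimage hset hmL]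
  have hpre : (Complex.measurableEquivRealProd.symm ⁻¹' {w : ℂ | 0 < w.re}) = Ioi (0:ℝ) ×ˢ univ := by
    ext p; simp
  rw [hpre, Measure.volume_eq_prod, ← Measure.prod_restrict, Measure.restrict_univ,
    lintegral_prod _ (by
      exact (hmL.comp (Complex.measurableEquivRealProd.symm.measurable)).aemeasurable)]
  simp only [Complex.measurableEquivRealProd_symm_apply]
  have step1 : ∫⁻ x in Ioi (0:ℝ), ∫⁻ y : ℝ, ENNReal.ofReal (‖lapAux g (⟨x, y⟩ : ℂ)‖ ^ 2) =
      ∫⁻ x in Ioi (0:ℝ), ENNReal.ofReal (2 * Real.pi) *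
        ∫⁻ u, ENNReal.ofReal (Real.exp (-(2 * u) * x)) * ENNReal.ofReal (‖g u‖ ^ 2) :=
    setLIntegral_congr_fun measurableSet_Ioi fun x hx => lap_vertical g hg h0 hi x hx
  rw [step1, lintegral_const_mul' _ _ ENNReal.ofReal_ne_top, lintegral_lintegral_swap (by
    simp only [Function.uncurry_def]
    fun_prop)]
  have step2 : ∀ u : ℝ, (∫⁻ x in Ioi (0:ℝ), ENNReal.ofReal (Real.exp (-(2 * u) * x)) *
      ENNReal.ofReal (‖g u‖ ^ 2)) = ENNReal.ofReal (1 / 2) * ENNReal.ofReal (‖g u‖ ^ 2 / u) := by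
    intro u
    rw [lintegral_mul_const' _ _ ENNReal.ofReal_ne_top]
    rcases le_or_gt u 0 with hu | hu
    · simp [h0 u hu]
    rw [← ofReal_integral_eq_lintegral_ofReal, integral_exp_mul_Ioi (by linarith),
      ← ENNReal.ofReal_mul, ← ENNReal.ofReal_mul (by norm_num)]
    · congr 1
      simp
      field_simp
    · simp; positivity
    · exact integrableOn_exp_mul_Ioi (by linarith) 0
    · exact ae_of_all _ fun x => (Real.exp_pos _).le
  simp only [step2]
  rw [lintegral_const_mul' _ _ ENNReal.ofReal_ne_top, ← mul_assoc,
    ← ENNReal.ofReal_mul (by positivity)]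
  congr 2
  ring

theorem sector_image : (fun z : ℂ => z ^ 2) '' SectorDelta = {w : ℂ | 0 < w.re} := by
  have hre : ∀ s : ℂ, (s ^ 2).re = s.re ^ 2 - s.im ^ 2 := by
    intro s; simp [pow_two]
  ext w
  simp only [SectorDelta, mem_image, mem_ofPred_eq]
  constructor
  · rintro ⟨s, ⟨h1, h2⟩, rfl⟩
    rw [hre]
    have := sq_lt_sq' (by linarith [abs_nonneg s.im]) h2
    rw [sq_abs] at this
    linarith
  · intro hw
    obtain ⟨s, hs⟩ := IsAlgClosed.exists_pow_nat_eq w (n := 2) (by norm_num)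
    have h1 : s.im ^ 2 < s.re ^ 2 := by
      have := hre s
      rw [hs] at this
      linarith
    have h2 := sq_lt_sq.1 h1
    have h3 : s.re ≠ 0 := by
      intro h; rw [h, abs_zero] at h2; linarith [abs_nonneg s.im]
    rcases h3.lt_or_gt with h | h
    · exact ⟨-s, ⟨by simpa using h, by simpa [abs_of_neg h] using h2⟩, by simpa using hs⟩
    · exact ⟨s, ⟨h, by simpa [abs_of_pos h] using h2⟩, hs⟩

theorem sector_injOn : InjOn (fun z : ℂ => z ^ 2) SectorDelta := by
  intro a ha b hb hab
  rcases sq_eq_sq_iff_eq_or_eq_neg.1 hab with h | h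
  · exact h
  · have h1 := ha.1
    have h2 := hb.1
    rw [h] at h1
    simp at h1
    linarith

theorem sector_isOpen : IsOpen SectorDelta :=
  (isOpen_lt continuous_const Complex.continuous_re).inter
    (isOpen_lt Complex.continuous_im.abs Complex.continuous_re)

theorem sector_lintegral (G : ℂ → ENNReal) :
    ∫⁻ w in {w : ℂ | 0 < w.re}, G w =
      ∫⁻ s in SectorDelta, ENNReal.ofReal (4 * ‖s‖ ^ 2) * G (s ^ 2) := by
  rw [← sector_image]
  have := lintegral_image_eq_lintegral_abs_det_fderiv_mul (volume : Measure ℂ)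
    sector_isOpen.measurableSet (f := fun z : ℂ => z ^ 2)
    (f' := fun s => (ContinuousLinearMap.toSpanSingleton ℂ (2 * s)).restrictScalars ℝ)
    (fun s _ => by
      have : HasDerivAt (fun z : ℂ => z ^ 2) (2 * s) s := by
        simpa using hasDerivAt_pow 2 s
      exact (this.hasFDerivAt.restrictScalars ℝ).hasFDerivWithinAt) sector_injOn G
  rw [this]
  congr 1
  ext s
  congr 2
  simp [ContinuousLinearMap.det, LinearMap.det_restrictScalars,
      Algebra.norm_complex_eq, Complex.normSq_eq_norm_sq, mul_pow]
  norm_num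

/-- The substitution `u = 1/(4(τ-σ))`. -/
def substAux (τ σ : ℝ) : ℝ := 1 / (4 * (τ - σ))

theorem subst_image (τ : ℝ) (hτ : 0 < τ) : substAux τ '' Ioo 0 τ = Ioi (1 / (4 * τ)) := by
  ext u
  simp only [substAux, mem_image, mem_Ioo, mem_Ioi]
  constructor
  · rintro ⟨σ, ⟨h1, h2⟩, rfl⟩
    apply one_div_lt_one_div_of_lt <;> linarith
  · intro hu
    have hu0 : 0 < u := lt_trans (by positivity) hu
    refine ⟨τ - 1 / (4 * u), ⟨?_, ?_⟩, ?_⟩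
    · rw [div_lt_iff₀ (by positivity)] at hu
      rw [sub_pos, div_lt_iff₀ (by positivity)]
      linarith
    · have : 0 < 1 / (4 * u) := by positivity
      linarith
    · field_simp; ring

theorem subst_injOn (τ : ℝ) : InjOn (substAux τ) (Ioo 0 τ) := by
  intro a ha b hb hab
  have h1 : 0 < τ - a := sub_pos.2 ha.2
  have h2 : 0 < τ - b := sub_pos.2 hb.2
  simp only [substAux] at hab
  field_simp at hab
  linarith

theorem subst_deriv (τ : ℝ) : ∀ σ ∈ Ioo 0 τ,
    HasDerivWithinAt (substAux τ) (1 / (4 * (τ - σ) ^ 2)) (Ioo 0 τ) σ := by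
  intro σ hσ
  have h1 : 0 < τ - σ := sub_pos.2 hσ.2
  have h2 : HasDerivAt (fun σ => 4 * (τ - σ)) (-4) σ := by
    simpa using ((hasDerivAt_id σ).const_sub τ).const_mul 4
  have h3 := h2.inv (by positivity)
  have h4 : HasDerivAt (substAux τ) (-(-4) / (4 * (τ - σ)) ^ 2) σ := by
    refine h3.congr_of_eventuallyEq (Filter.Eventually.of_forall fun x => ?_)
    simp [substAux]
  have h5 : 1 / (4 * (τ - σ) ^ 2) = -(-4) / (4 * (τ - σ)) ^ 2 := by
    field_simp
  rw [h5]
  exact h4.hasDerivWithinAt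

/-- The transformed density. -/
def gAux (τ : ℝ) (f : ℝ → ℂ) : ℝ → ℂ :=
  (Ioi (1 / (4 * τ))).indicator fun u => ((1 / Real.sqrt u : ℝ) : ℂ) * f (τ - 1 / (4 * u))

theorem gAux_measurable (τ : ℝ) (f : ℝ → ℂ) (hf : Measurable f) : Measurable (gAux τ f) := by
  unfold gAux
  refine Measurable.indicator ?_ measurableSet_Ioi
  fun_prop

theorem gAux_zero (τ : ℝ) (hτ : 0 < τ) (f : ℝ → ℂ) (u : ℝ) (hu : u ≤ 0) : gAux τ f u = 0 := by
  unfold gAux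
  apply indicator_of_notMem
  have : 0 < 1 / (4 * τ) := by positivity
  simp only [mem_Ioi, not_lt]
  linarith

theorem gAux_subst (τ : ℝ) (hτ : 0 < τ) (f : ℝ → ℂ) (σ : ℝ) (hσ : σ ∈ Ioo 0 τ) :
    gAux τ f (substAux τ σ) = ((2 * Real.sqrt (τ - σ) : ℝ) : ℂ) * f σ := by
  have h1 : 0 < τ - σ := sub_pos.2 hσ.2
  have hm : substAux τ σ ∈ Ioi (1 / (4 * τ)) := by
    rw [← subst_image τ hτ]; exact mem_image_of_mem _ hσ
  have e1 : τ - 1 / (4 * substAux τ σ) = σ := by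
    unfold substAux; field_simp; ring
  have e2 : 1 / Real.sqrt (substAux τ σ) = 2 * Real.sqrt (τ - σ) := by
    unfold substAux
    rw [one_div (4 * (τ - σ)), Real.sqrt_inv, one_div, inv_inv, Real.sqrt_mul (by norm_num),
      show (4:ℝ) = 2 ^ 2 by norm_num, Real.sqrt_sq (by norm_num)]
  unfold gAux
  rw [indicator_of_mem hm, e1, e2]

theorem gAux_lintegral (τ : ℝ) (hτ : 0 < τ) (f : ℝ → ℂ) :
    ∫⁻ u, ENNReal.ofReal (‖gAux τ f u‖ ^ 2 / u) =
      ENNReal.ofReal 4 * ∫⁻ σ in Ioo 0 τ, ENNReal.ofReal (‖f σ‖ ^ 2) := by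
  have h1 : ∫⁻ u, ENNReal.ofReal (‖gAux τ f u‖ ^ 2 / u) =
      ∫⁻ u in Ioi (1 / (4 * τ)), ENNReal.ofReal (‖gAux τ f u‖ ^ 2 / u) := by
    rw [← lintegral_indicator measurableSet_Ioi]
    congr 1
    ext u
    by_cases hu : u ∈ Ioi (1 / (4 * τ))
    · rw [indicator_of_mem hu]
    · rw [indicator_of_notMem hu, gAux, indicator_of_notMem hu]; simp
  rw [h1, ← subst_image τ hτ, lintegral_image_eq_lintegral_abs_deriv_mul measurableSet_Ioo
    (subst_deriv τ) (subst_injOn τ), ← lintegral_const_mul' _ _ ENNReal.ofReal_ne_top]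
  refine setLIntegral_congr_fun measurableSet_Ioo fun σ hσ => ?_
  have h2 : 0 < τ - σ := sub_pos.2 hσ.2
  simp only [gAux_subst τ hτ f σ hσ]
  rw [← ENNReal.ofReal_mul (by positivity), ← ENNReal.ofReal_mul (by norm_num),
    abs_of_pos (by positivity), norm_mul, Complex.norm_real, Real.norm_of_nonneg (by positivity),
    mul_pow, mul_pow, Real.sq_sqrt h2.le, substAux]
  congr 1
  field_simp
  norm_num

theorem gAux_integrable (τ : ℝ) (hτ : 0 < τ) (f : ℝ → ℂ) (hf : Measurable f)
    (hL2 : ∫⁻ σ in Ioo (0:ℝ) τ, ENNReal.ofReal (‖f σ‖ ^ 2) < ⊤) :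
    Integrable fun u => ‖gAux τ f u‖ ^ 2 / u := by
  have hm := gAux_measurable τ f hf
  refine ⟨((hm.norm.pow_const 2).div measurable_id).aestronglyMeasurable, ?_⟩
  rw [hasFiniteIntegral_iff_ofReal, gAux_lintegral τ hτ f]
  · exact ENNReal.mul_lt_top ENNReal.ofReal_lt_top hL2
  · refine ae_of_all _ fun u => ?_
    rcases le_or_gt u 0 with hu | hu
    · simp [gAux_zero τ hτ f u hu]
    · simp only [Pi.zero_apply]; positivity

theorem phi_eq_lap (τ : ℝ) (hτ : 0 < τ) (f : ℝ → ℂ) (s : ℂ) :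
    PhiTilde τ f s = s / ((Real.sqrt Real.pi : ℝ) : ℂ) * lapAux (gAux τ f) (s ^ 2) := by
  have h1 : lapAux (gAux τ f) (s ^ 2) =
      ∫ u in Ioi (1 / (4 * τ)), Complex.exp (-s ^ 2 * u) * gAux τ f u := by
    rw [← integral_indicator measurableSet_Ioi, lapAux]
    congr 1
    ext u
    by_cases hu : u ∈ Ioi (1 / (4 * τ))
    · rw [indicator_of_mem hu]
    · rw [indicator_of_notMem hu, gAux, indicator_of_notMem hu]; simp
  rw [h1, ← subst_image τ hτ, integral_image_eq_integral_abs_deriv_smul measurableSet_Ioo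
    (subst_deriv τ) (subst_injOn τ), PhiTilde, ← integral_const_mul]
  refine setIntegral_congr_fun measurableSet_Ioo fun σ hσ => ?_
  have h2 : 0 < τ - σ := sub_pos.2 hσ.2
  have hpi : ((Real.sqrt Real.pi : ℝ) : ℂ) ≠ 0 := by
    exact_mod_cast (Real.sqrt_pos.2 Real.pi_pos).ne'
  simp only [gAux_subst τ hτ f σ hσ]
  have e1 : (τ - σ) ^ ((3:ℝ)/2) = (τ - σ) * Real.sqrt (τ - σ) := by
    rw [Real.sqrt_eq_rpow, show (3:ℝ)/2 = 1 + 1/2 by norm_num, Real.rpow_add h2, Real.rpow_one]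
  have e2 : -s ^ 2 / (4 * ((τ : ℂ) - (σ : ℂ))) = -s ^ 2 * (substAux τ σ : ℂ) := by
    unfold substAux; push_cast; ring
  have e3 : |1 / (4 * (τ - σ) ^ 2)| * (2 * Real.sqrt (τ - σ))
      = 1 / (2 * ((τ - σ) * Real.sqrt (τ - σ))) := by
    have hs : 0 < Real.sqrt (τ - σ) := Real.sqrt_pos.2 h2
    have hs2 : Real.sqrt (τ - σ) ^ 2 = τ - σ := Real.sq_sqrt h2.le
    rw [abs_of_pos (by positivity)]
    field_simp
    rw [hs2]; norm_num
  have e4 : ((|1 / (4 * (τ - σ) ^ 2)| : ℝ) : ℂ) * ((2 * Real.sqrt (τ - σ) : ℝ) : ℂ)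
      = 1 / (2 * (((τ - σ) * Real.sqrt (τ - σ) : ℝ) : ℂ)) := by
    rw [← Complex.ofReal_mul, e3]; push_cast; rfl
  rw [e1, e2, Complex.real_smul]
  calc _ = s / ((Real.sqrt Real.pi : ℝ) : ℂ) * Complex.exp (-s ^ 2 * (substAux τ σ : ℂ)) *
        (1 / (2 * (((τ - σ) * Real.sqrt (τ - σ) : ℝ) : ℂ))) * f σ := by
        simp only [div_eq_mul_inv, mul_inv]; ring
    _ = _ := by rw [← e4]; ring

/-- `Φ̃_τ` is an isometry from `L²((0,τ))` into the Bergman space `A²(Δ)`. -/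
theorem phiTilde_isometry_into_bergman (τ : ℝ) (hτ : 0 < τ) (f : ℝ → ℂ)
    (hmeas : Measurable f)
    (hL2 : ∫⁻ σ in Ioo (0:ℝ) τ, ENNReal.ofReal (‖f σ‖ ^ 2) < ⊤) :
    DifferentiableOn ℂ (PhiTilde τ f) SectorDelta ∧
    ∫⁻ z in SectorDelta, ENNReal.ofReal (‖PhiTilde τ f z‖ ^ 2)
      = ∫⁻ σ in Ioo (0:ℝ) τ, ENNReal.ofReal (‖f σ‖ ^ 2) := by
  have hg := gAux_measurable τ f hmeas
  have h0 := gAux_zero τ hτ f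
  have hi := gAux_integrable τ hτ f hmeas hL2
  have hpi := Real.pi_pos
  have hphi : PhiTilde τ f =
      fun s => s / ((Real.sqrt Real.pi : ℝ) : ℂ) * lapAux (gAux τ f) (s ^ 2) :=
    funext (phi_eq_lap τ hτ f)
  constructor
  · intro s hs
    have hw : 0 < (s ^ 2).re := by
      have : s ^ 2 ∈ (fun z : ℂ => z ^ 2) '' SectorDelta := mem_image_of_mem _ hs
      rw [sector_image] at this
      exact this
    have hd := lap_differentiableAt _ hg h0 hi (s ^ 2) hw
    have hc : DifferentiableAt ℂ (fun s : ℂ => lapAux (gAux τ f) (s ^ 2)) s :=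
      DifferentiableAt.comp (g := lapAux (gAux τ f)) (f := fun s : ℂ => s ^ 2) s hd (by fun_prop)
    rw [hphi]
    exact ((differentiableAt_id.div_const _).mul hc).differentiableWithinAt
  · have e1 : ∀ s : ℂ, ENNReal.ofReal (‖PhiTilde τ f s‖ ^ 2) = ENNReal.ofReal (1 / (4 * Real.pi)) *
        (ENNReal.ofReal (4 * ‖s‖ ^ 2) * ENNReal.ofReal (‖lapAux (gAux τ f) (s ^ 2)‖ ^ 2)) := by
      intro s
      rw [← ENNReal.ofReal_mul (by positivity), ← ENNReal.ofReal_mul (by positivity), hphi]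
      congr 1
      simp only [norm_mul, norm_div, Complex.norm_real]
      rw [Real.norm_of_nonneg (Real.sqrt_nonneg _), mul_pow, div_pow, Real.sq_sqrt hpi.le]
      field_simp
    simp only [e1]
    rw [lintegral_const_mul' _ _ ENNReal.ofReal_ne_top,
      ← sector_lintegral fun w => ENNReal.ofReal (‖lapAux (gAux τ f) w‖ ^ 2),
      lap_halfplane _ hg h0 hi, gAux_lintegral τ hτ f, ← mul_assoc, ← mul_assoc,
      ← ENNReal.ofReal_mul (by positivity), ← ENNReal.ofReal_mul (by positivity)]
    have : 1 / (4 * Real.pi) * Real.pi * 4 = 1 := by field_simp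
    rw [this, ENNReal.ofReal_one, one_mul]

end
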